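/- Let π = (5, 4^i, 3^j, 2^k, 1^{n−i−j−k−1}) where n ≥ 6, i, j, k ≥ 0, i + j ≥ 5, i + j + k ≤ n − 1, and σ(π) is even. Then π is potentially K6−C5-graphic if and only if π is none of the sequences (5, 3^5, 2), (5, 3^5, 2^2), (5, 3^7), (5, 3^6, 1), (5, 3^6, 2, 1), (5, 3^7, 2), (5, 3^8, 1), (5, 3^7, 1^2), (5, 4, 3^5), (5, 4, 3^5, 2), (5, 4, 3^7), (5, 4, 3^6, 1), (5, 4^2, 3^5). -/

import Mathlib

/-- The degree of vertex `i` in the simple graph `G`. -/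
noncomputable def degCount {n : ℕ} (G : SimpleGraph (Fin n)) (i : Fin n) : ℕ :=
  {j | G.Adj i j}.ncard

/-- The graph `K₆ − C₅`: the complete graph on 6 vertices minus the edges of a
cycle on 5 of its vertices.  Vertex `0` is adjacent to all other vertices, and the
vertices `1,…,5` carry the complement of a 5-cycle (which is again a 5-cycle).
Its degree sequence is `(5,3,3,3,3,3)`. -/
def K6C5 : SimpleGraph (Fin 6) :=
  SimpleGraph.fromRel (fun a b =>
    a = 0 ∨ b = 0 ∨
      (a, b) ∈ ([(1, 3), (3, 5), (5, 2), (2, 4), (4, 1)] : List (Fin 6 × Fin 6)))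

/-- A list of natural numbers is graphic if it is the degree sequence of some
simple graph. -/
def IsGraphic (l : List ℕ) : Prop :=
  ∃ G : SimpleGraph (Fin l.length), ∀ i : Fin l.length, degCount G i = l.get i

/-- A list of natural numbers is potentially `K₆ − C₅`-graphic if it has a
realization containing `K₆ − C₅` as a subgraph. -/
def PotentiallyK6C5 (l : List ℕ) : Prop :=
  ∃ G : SimpleGraph (Fin l.length),
    (∀ i : Fin l.length, degCount G i = l.get i) ∧
    ∃ f : Fin 6 → Fin l.length, Function.Injective f ∧
      ∀ a b : Fin 6, K6C5.Adj a b → G.Adj (f a) (f b)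

open Finset

instance : DecidableRel K6C5.Adj := fun a b =>
  inferInstanceAs (Decidable (a ≠ b ∧ (_ ∨ _)))

/-! ### A necessary condition -/

section Necessity

variable {V : Type*}

/-- The inequality forced on a degree function `d` by a copy of `K₆ − C₅` all of whose vertices
have degree at least `t`. -/
def CountingBound [Fintype V] (d : V → ℕ) (t : ℕ) : Prop :=
  2 * (t * (#{v | t ≤ d v} - 6)) + 20 ≤
    (#{v | t ≤ d v} - 6) * (#{v | t ≤ d v} - 6 - 1) +
      ∑ v with ¬ t ≤ d v, min (d v) (#{v | t ≤ d v} - 6) + ∑ v with t ≤ d v, d v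

instance [Fintype V] (d : V → ℕ) (t : ℕ) : Decidable (CountingBound d t) :=
  inferInstanceAs (Decidable (_ ≤ _))

variable (G : SimpleGraph V) [DecidableRel G.Adj]

theorem sum_card_adj_comm (s u : Finset V) :
    ∑ v ∈ s, #{w ∈ u | G.Adj v w} = ∑ w ∈ u, #{v ∈ s | G.Adj w v} := by
  have h := sum_card_bipartiteAbove_eq_sum_card_bipartiteBelow (s := s) (t := u) G.Adj
  simpa only [bipartiteAbove, bipartiteBelow, G.adj_comm] using h

variable {G} [DecidableEq V]

theorem card_adj_K6C5_le (f : SimpleGraph.Copy K6C5 G) (a : Fin 6) :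
    #{b | K6C5.Adj a b} ≤ #{w ∈ univ.image f | G.Adj (f a) w} := by
  refine card_le_card_of_injOn f (fun b hb => ?_) f.injective.injOn
  have hb' : K6C5.Adj a b := by simpa using hb
  simpa using f.toHom.map_adj hb'

theorem countingBound_of_copy [Fintype V] (f : SimpleGraph.Copy K6C5 G) {d : V → ℕ}
    (hd : ∀ v, #{w | G.Adj v w} = d v) {t : ℕ} (ht : t ≤ 3) : CountingBound d t := by
  have hf : Function.Injective f := f.injective
  set A : Finset V := {v | t ≤ d v} with hA
  set S : Finset V := univ.image f with hS
  set B : Finset V := {v | ¬ t ≤ d v} with hB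
  have hSA : S ⊆ A := by
    intro v hv
    obtain ⟨a, -, rfl⟩ := mem_image.1 hv
    have h3 : ∀ a, 3 ≤ #{b | K6C5.Adj a b} := by decide
    refine mem_filter.2 ⟨mem_univ _, ?_⟩
    calc t ≤ 3 := ht
      _ ≤ _ := h3 a
      _ ≤ _ := card_adj_K6C5_le f a
      _ ≤ _ := card_le_card (filter_subset_filter _ (subset_univ _))
      _ = _ := hd (f a)
  set U := A \ S with hU
  have hScard : #S = 6 := by rw [hS, card_image_of_injective _ hf, card_univ, Fintype.card_fin]
  have hUcard : #U = #A - 6 := by rw [hU, card_sdiff_of_subset hSA, hScard]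
  have hsplit : ∀ v, d v =
      #{w ∈ B | G.Adj v w} + (#{w ∈ U | G.Adj v w} + #{w ∈ S | G.Adj v w}) := by
    intro v
    rw [← hd v, ← card_union_of_disjoint, ← card_union_of_disjoint, ← filter_union,
      ← filter_union, hU, sdiff_union_of_subset hSA, union_comm, hA, hB, filter_union_filter_not_eq]
    · rw [← filter_union]
      refine disjoint_filter_filter ?_
      rw [hU, sdiff_union_of_subset hSA]
      exact (disjoint_filter_filter_not _ _ _).symm
    · exact disjoint_filter_filter sdiff_disjoint
  have hUsum : ∑ v ∈ U, d v = ∑ v ∈ B, #{w ∈ U | G.Adj v w} +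
      (∑ v ∈ U, #{w ∈ U | G.Adj v w} + ∑ v ∈ S, #{w ∈ U | G.Adj v w}) := by
    rw [← sum_card_adj_comm G U B, ← sum_card_adj_comm G U S, ← sum_add_distrib,
      ← sum_add_distrib]
    exact sum_congr rfl fun v _ => hsplit v
  have hBU : ∑ v ∈ B, #{w ∈ U | G.Adj v w} ≤ ∑ v ∈ B, min (d v) (#A - 6) := by
    refine sum_le_sum fun v _ => le_min ?_ (hUcard ▸ card_filter_le _ _)
    have := hsplit v
    omega
  have hUU : ∑ v ∈ U, #{w ∈ U | G.Adj v w} ≤ (#A - 6) * (#A - 6 - 1) := by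
    rw [← hUcard, ← smul_eq_mul]
    refine sum_le_card_nsmul _ _ _ fun v hv => ?_
    rw [← card_erase_of_mem hv]
    refine card_le_card fun w hw => ?_
    rw [mem_filter] at hw
    exact mem_erase.2 ⟨hw.2.ne', hw.1⟩
  have hSS : 20 ≤ ∑ v ∈ S, #{w ∈ S | G.Adj v w} := by
    rw [hS, sum_image hf.injOn]
    calc 20 = ∑ a, #{b | K6C5.Adj a b} := by decide
      _ ≤ _ := sum_le_sum fun a _ => card_adj_K6C5_le f a
  have hSU : ∑ v ∈ S, #{w ∈ U | G.Adj v w} + ∑ v ∈ S, #{w ∈ S | G.Adj v w} ≤ ∑ v ∈ S, d v := by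
    rw [← sum_add_distrib]
    refine sum_le_sum fun v _ => ?_
    have := hsplit v
    omega
  have hAsum : ∑ v ∈ U, d v + ∑ v ∈ S, d v = ∑ v ∈ A, d v := sum_sdiff hSA
  have htU : t * (#A - 6) ≤ ∑ v ∈ U, d v := by
    rw [← hUcard, mul_comm, ← smul_eq_mul]
    refine card_nsmul_le_sum _ _ _ fun v hv => ?_
    simpa [hA] using (mem_sdiff.1 hv).1
  unfold CountingBound
  rw [← hA, ← hB]
  omega

end Necessity

theorem PotentiallyK6C5.countingBound {l : List ℕ} (h : PotentiallyK6C5 l) {t : ℕ} (ht : t ≤ 3) :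
    CountingBound l.get t := by
  classical
  obtain ⟨G, hG, f, hf, hadj⟩ := h
  refine countingBound_of_copy (G := G) ⟨⟨f, hadj _ _⟩, hf⟩ (fun v => ?_) ht
  rw [← hG v, degCount, Set.ncard_eq_toFinset_card']
  simp

/-! ### Realizations with a copy of `K₆ − C₅` -/

/-- `s` is the multiset of degrees of a finite simple graph containing `K₆ − C₅`. -/
def RealizableWithCore (s : Multiset ℕ) : Prop :=
  ∃ (V : Type) (_ : Fintype V) (G : SimpleGraph V), K6C5.IsContained G ∧
    (univ : Finset V).val.map (fun v => (G.neighborSet v).ncard) = s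

theorem RealizableWithCore.potentiallyK6C5 {l : List ℕ} (h : RealizableWithCore l) :
    PotentiallyK6C5 l := by
  classical
  obtain ⟨V, _, G, ⟨f⟩, hs⟩ := h
  have hfib : ∀ c, Fintype.card {v // (G.neighborSet v).ncard = c} =
      Fintype.card {x // l.get x = c} := by
    intro c
    have hl : (univ : Finset (Fin l.length)).val.map l.get = (l : Multiset ℕ) := by simp
    have := congrArg (Multiset.count c) (hs.trans hl.symm)
    rw [Multiset.count_map, Multiset.count_map] at this
    simp only [Fintype.card_subtype, card_def, filter_val]
    simpa only [eq_comm] using this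
  let e : V ≃ Fin l.length := Equiv.ofFiberEquiv fun c => Fintype.equivOfCardEq (hfib c)
  have he : ∀ v, l.get (e v) = (G.neighborSet v).ncard := fun v => Equiv.ofFiberEquiv_map _ v
  refine ⟨G.comap e.symm, fun x => ?_, e ∘ f, e.injective.comp f.injective, fun a b hab => ?_⟩
  · obtain ⟨v, rfl⟩ := e.surjective x
    rw [he, ← Set.ncard_image_of_injective _ e.injective]
    refine congrArg Set.ncard (Set.ext fun y => ?_)
    simp
  · simpa using f.toHom.map_adj hab

/-- Adding a disjoint complete graph. -/
theorem RealizableWithCore.add_complete {s : Multiset ℕ} (h : RealizableWithCore s) (r : ℕ) :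
    RealizableWithCore (s + Multiset.replicate r (r - 1)) := by
  obtain ⟨V, _, G, hf, rfl⟩ := h
  refine ⟨V ⊕ Fin r, inferInstance, G.sum ⊤, hf.trans ⟨SimpleGraph.Embedding.sumInl.toCopy⟩, ?_⟩
  rw [← univ_disjSum_univ, val_disjSum, Multiset.disjSum, Multiset.map_add, Multiset.map_map,
    Multiset.map_map]
  congr 1
  · refine Multiset.map_congr rfl fun v _ => ?_
    simp [SimpleGraph.neighborSet_sum_inl, Set.ncard_image_of_injective _ Sum.inl_injective]
  · refine Multiset.eq_replicate.2 ⟨by simp, fun b hb => ?_⟩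
    obtain ⟨w, -, rfl⟩ := Multiset.mem_map.1 hb
    simp [SimpleGraph.neighborSet_sum_inr, Set.ncard_image_of_injective _ Sum.inr_injective,
      Set.ncard_eq_toFinset_card', card_compl]

/-- The graph obtained from `G` by replacing the edge `xy` by a path of length two through the
new vertex `none`. -/
def subdivide {V : Type} (G : SimpleGraph V) (x y : V) : SimpleGraph (Option V) where
  Adj
    | some a, some b => G.Adj a b ∧ s(a, b) ≠ s(x, y)
    | none, some b => b = x ∨ b = y
    | some a, none => a = x ∨ a = y
    | none, none => False
  symm := ⟨by
    rintro (_ | a) (_ | b) h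
    · exact h
    · exact h
    · exact h
    · exact ⟨h.1.symm, Sym2.eq_swap (a := a) ▸ h.2⟩⟩
  loopless := ⟨by
    rintro (_ | a) h
    · exact h
    · exact h.1.ne rfl⟩

theorem ncard_neighborSet_subdivide_none {V : Type} {G : SimpleGraph V} {x y : V}
    (h : G.Adj x y) : ((subdivide G x y).neighborSet none).ncard = 2 := by
  rw [← Set.ncard_pair h.ne, ← Set.ncard_image_of_injective _ (Option.some_injective V)]
  refine congrArg Set.ncard (Set.ext ?_)
  rintro (_ | b) <;> simp [subdivide]

theorem ncard_neighborSet_subdivide_some {V : Type} {G : SimpleGraph V} {x y : V}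
    (h : G.Adj x y) (a : V) :
    ((subdivide G x y).neighborSet (some a)).ncard = (G.neighborSet a).ncard := by
  classical
  let φ : V → Option V := fun b => if s(a, b) = s(x, y) then none else some b
  have hφ : Function.Injective φ := by
    intro b c hbc
    by_cases hb : s(a, b) = s(x, y) <;> by_cases hc : s(a, c) = s(x, y) <;>
      simp only [φ, hb, hc, if_true, if_false, reduceCtorEq, Option.some.injEq] at hbc
    · exact Sym2.congr_right.1 (hb.trans hc.symm)
    · exact hbc
  rw [← Set.ncard_image_of_injective _ hφ]
  refine congrArg Set.ncard (Set.ext ?_)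
  rintro (_ | b)
  · constructor
    · rintro (rfl | rfl)
      · exact ⟨y, h, by simp [φ]⟩
      · exact ⟨x, h.symm, by simp [φ]⟩
    · rintro ⟨c, -, hc⟩
      have hc' : s(a, c) = s(x, y) := by simpa only [φ, ite_eq_left_iff, reduceCtorEq, imp_false,
        not_not] using hc
      rcases Sym2.eq_iff.1 hc' with h | h
      · exact Or.inl h.1
      · exact Or.inr h.1
  · constructor
    · rintro ⟨hab, hne⟩
      exact ⟨b, hab, if_neg hne⟩
    · rintro ⟨c, hac, hc⟩
      by_cases hne : s(a, c) = s(x, y)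
      · simp only [φ, hne, if_true, reduceCtorEq] at hc
      · simp only [φ, hne, if_false, Option.some.injEq] at hc
        exact hc ▸ ⟨hac, hne⟩

/-- Subdividing an edge at a vertex outside the copy of `K₆ − C₅`. -/
theorem RealizableWithCore.cons_two {s : Multiset ℕ} (h : RealizableWithCore s)
    (hcard : 6 < s.card) (h0 : 0 ∉ s) : RealizableWithCore (2 ::ₘ s) := by
  classical
  obtain ⟨V, _, G, ⟨f⟩, rfl⟩ := h
  have hf : Function.Injective f := f.injective
  obtain ⟨x, hx⟩ : ∃ x, x ∉ univ.image f := by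
    by_contra! hall
    have := card_le_card (fun v _ => hall v : (univ : Finset V) ⊆ univ.image f)
    rw [card_image_of_injective _ hf, card_univ, card_univ, Fintype.card_fin] at this
    rw [Multiset.card_map, card_val, card_univ] at hcard
    omega
  obtain ⟨y, hxy⟩ : (G.neighborSet x).Nonempty := by
    refine Set.nonempty_of_ncard_ne_zero fun hzero => h0 ?_
    exact Multiset.mem_map.2 ⟨x, mem_univ_val x, hzero⟩
  have hcopy : ∀ {a b}, K6C5.Adj a b → (subdivide G x y).Adj (some (f a)) (some (f b)) := by
    refine fun {a b} hab => ⟨f.toHom.map_adj hab, fun heq => hx ?_⟩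
    rcases Sym2.eq_iff.1 heq with h | h
    · exact mem_image.2 ⟨a, mem_univ _, h.1⟩
    · exact mem_image.2 ⟨b, mem_univ _, h.2⟩
  refine ⟨Option V, inferInstance, subdivide G x y,
    ⟨⟨⟨some ∘ f, hcopy⟩, (Option.some_injective V).comp hf⟩⟩, ?_⟩
  rw [univ_option]
  change Multiset.map _ (none ::ₘ univ.val.map some) = _
  rw [Multiset.map_cons, Multiset.map_map, ncard_neighborSet_subdivide_none hxy]
  simp only [Function.comp_def, ncard_neighborSet_subdivide_some hxy]

/-! ### Sequences given by their multiplicities -/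

/-- The degree multiset `(5, 4^i, 3^j, 2^k, 1^m)`. -/
def degreeMultiset (i j k m : ℕ) : Multiset ℕ :=
  5 ::ₘ (Multiset.replicate i 4 + Multiset.replicate j 3 + Multiset.replicate k 2 +
    Multiset.replicate m 1)

theorem card_degreeMultiset (i j k m : ℕ) :
    (degreeMultiset i j k m).card = i + j + k + m + 1 := by
  simp [degreeMultiset]

theorem zero_notMem_degreeMultiset (i j k m : ℕ) : 0 ∉ degreeMultiset i j k m := by
  simp [degreeMultiset, Multiset.mem_replicate]

/-- The multiplicities `(i, j, k, m)` of the sequences that are not potentially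
`K₆ − C₅`-graphic. -/
def exceptions : List (ℕ × ℕ × ℕ × ℕ) :=
  [(0, 5, 1, 0), (0, 5, 2, 0), (0, 7, 0, 0), (0, 6, 0, 1), (0, 6, 1, 1), (0, 7, 1, 0),
    (0, 8, 0, 1), (0, 7, 0, 2), (1, 5, 0, 0), (1, 5, 1, 0), (1, 7, 0, 0), (1, 6, 0, 1),
    (2, 5, 0, 0)]

/-- The multiplicities for which a realization containing `K₆ − C₅` is claimed. -/
def Admissible (i j k m : ℕ) : Prop :=
  5 ≤ i + j ∧ (j + m) % 2 = 1 ∧ (i, j, k, m) ∉ exceptions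

instance (i j k m : ℕ) : Decidable (Admissible i j k m) :=
  inferInstanceAs (Decidable (_ ∧ _ ∧ _))

/-! ### Explicit realizations -/

/-- The edges of `K₆ − C₅` on the vertices `0, …, 5`. -/
def coreEdges : List (ℕ × ℕ) :=
  [(0, 1), (0, 2), (0, 3), (0, 4), (0, 5), (1, 3), (3, 5), (5, 2), (2, 4), (4, 1)]

/-- The graph on `N` vertices with edge set `coreEdges ++ E`. -/
def coreGraph (N : ℕ) (E : List (ℕ × ℕ)) : SimpleGraph (Fin N) :=
  SimpleGraph.fromRel fun a b => (a.val, b.val) ∈ coreEdges ++ E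

instance (N : ℕ) (E : List (ℕ × ℕ)) : DecidableRel (coreGraph N E).Adj := fun a b =>
  inferInstanceAs (Decidable (a ≠ b ∧ (_ ∨ _)))

/-- Multiplicities `(i, j, k, m)` together with the edges which, added to `coreEdges`, give a
graph with degrees `(5, 4^i, 3^j, 2^k, 1^m)`. -/
def smallRealizations : List (ℕ × ℕ × ℕ × ℕ × List (ℕ × ℕ)) := [
  (0, 5, 0, 0, []),
  (0, 6, 0, 3, [(6, 7), (6, 8), (6, 9)]),
  (0, 6, 2, 1, [(6, 7), (6, 8), (6, 9), (7, 8)]),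
  (0, 7, 0, 4, [(6, 7), (6, 10), (6, 11), (7, 8), (7, 9)]),
  (0, 7, 1, 2, [(6, 7), (6, 8), (6, 10), (7, 8), (7, 9)]),
  (0, 7, 2, 0, [(6, 7), (6, 8), (6, 9), (7, 8), (7, 9)]),
  (0, 8, 0, 3, [(6, 7), (6, 8), (6, 11), (7, 8), (7, 10), (8, 9)]),
  (0, 8, 1, 1, [(6, 7), (6, 8), (6, 10), (7, 8), (7, 9), (8, 9)]),
  (0, 10, 0, 1, [(6, 9), (6, 10), (6, 11), (7, 8), (7, 9), (7, 10), (8, 9), (8, 10)]),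
  (0, 11, 0, 0, [(6, 9), (6, 10), (6, 11), (7, 8), (7, 10), (7, 11), (8, 9), (8, 11), (9, 10)]),
  (0, 12, 0, 1, [(6, 9), (6, 11), (6, 12), (7, 9), (7, 10), (7, 12), (8, 10), (8, 12), (8, 13), (9, 11), (10, 11)]),
  (1, 4, 0, 1, [(3, 6)]),
  (1, 5, 0, 2, [(3, 6), (6, 7), (6, 8)]),
  (1, 5, 2, 0, [(3, 6), (6, 7), (6, 8), (7, 8)]),
  (1, 6, 0, 3, [(3, 7), (6, 7), (6, 9), (6, 10), (7, 8)]),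
  (1, 6, 1, 1, [(3, 7), (6, 7), (6, 8), (6, 9), (7, 8)]),
  (1, 7, 0, 2, [(3, 8), (6, 7), (6, 8), (6, 10), (7, 8), (7, 9)]),
  (1, 7, 1, 0, [(3, 7), (6, 7), (6, 8), (6, 9), (7, 8), (8, 9)]),
  (1, 9, 0, 0, [(3, 8), (6, 7), (6, 9), (6, 10), (7, 9), (7, 10), (8, 9), (8, 10)]),
  (1, 10, 0, 1, [(3, 9), (6, 10), (6, 11), (6, 12), (7, 8), (7, 10), (7, 11), (8, 9), (8, 11), (9, 10)]),
  (1, 11, 0, 0, [(3, 9), (6, 9), (6, 11), (6, 12), (7, 8), (7, 10), (7, 12), (8, 10), (8, 12), (9, 11), (10, 11)]),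
  (2, 3, 0, 0, [(1, 2)]),
  (2, 3, 1, 0, [(1, 6), (3, 6)]),
  (2, 4, 0, 1, [(1, 6), (3, 6), (6, 7)]),
  (2, 5, 0, 2, [(1, 7), (3, 7), (6, 7), (6, 8), (6, 9)]),
  (2, 5, 1, 0, [(1, 7), (3, 6), (6, 7), (6, 8), (7, 8)]),
  (2, 6, 0, 1, [(1, 8), (3, 7), (6, 7), (6, 8), (6, 9), (7, 8)]),
  (2, 9, 0, 0, [(1, 9), (3, 8), (6, 7), (6, 10), (6, 11), (7, 10), (7, 11), (8, 9), (8, 11), (9, 10)]),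
  (3, 2, 0, 1, [(2, 6), (4, 5)]),
  (3, 3, 0, 0, [(2, 6), (4, 6), (5, 6)]),
  (3, 4, 0, 1, [(2, 7), (4, 7), (5, 6), (6, 7), (6, 8)]),
  (3, 5, 0, 0, [(2, 8), (4, 7), (5, 6), (6, 7), (6, 8), (7, 8)]),
  (4, 1, 0, 0, [(1, 5), (3, 4)]),
  (4, 1, 1, 0, [(1, 6), (3, 6), (4, 5)]),
  (4, 2, 0, 1, [(1, 6), (3, 6), (4, 6), (5, 7)]),
  (4, 3, 0, 0, [(1, 7), (3, 7), (4, 6), (5, 6), (6, 7)]),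
  (4, 4, 0, 1, [(1, 8), (3, 7), (4, 9), (5, 6), (6, 7), (6, 8), (7, 8)]),
  (5, 0, 0, 1, [(1, 6), (2, 3), (4, 5)]),
  (5, 1, 0, 0, [(1, 6), (2, 6), (3, 6), (4, 5)]),
  (5, 2, 0, 1, [(1, 7), (2, 7), (3, 6), (4, 6), (5, 8), (6, 7)]),
  (5, 3, 0, 0, [(1, 8), (2, 7), (3, 6), (4, 5), (6, 7), (6, 8), (7, 8)]),
  (6, 0, 0, 1, [(1, 6), (2, 6), (3, 6), (4, 6), (5, 7)]),
  (6, 1, 0, 0, [(1, 6), (2, 6), (3, 6), (4, 7), (5, 7), (6, 7)]),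
  (6, 2, 0, 1, [(1, 6), (2, 6), (3, 8), (4, 9), (5, 7), (6, 7), (6, 8), (7, 8)]),
  (6, 3, 0, 0, [(1, 6), (2, 8), (3, 7), (4, 5), (6, 7), (6, 8), (6, 9), (7, 9), (8, 9)]),
  (7, 0, 0, 1, [(1, 7), (2, 7), (3, 7), (4, 6), (5, 6), (6, 7), (6, 8)]),
  (7, 1, 0, 0, [(1, 7), (2, 7), (3, 6), (4, 6), (5, 8), (6, 7), (6, 8), (7, 8)]),
  (7, 2, 0, 1, [(1, 7), (2, 6), (3, 10), (4, 9), (5, 8), (6, 7), (6, 8), (6, 9), (7, 8), (7, 9)]),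
  (8, 0, 0, 1, [(1, 8), (2, 8), (3, 7), (4, 7), (5, 6), (6, 7), (6, 8), (6, 9), (7, 8)]),
  (8, 1, 0, 0, [(1, 8), (2, 7), (3, 6), (4, 6), (5, 9), (6, 7), (6, 8), (7, 8), (7, 9), (8, 9)]),
  (9, 0, 0, 1, [(1, 9), (2, 8), (3, 7), (4, 10), (5, 6), (6, 7), (6, 8), (6, 9), (7, 8), (7, 9), (8, 9)])]

theorem isContained_coreGraph {N : ℕ} (hN : 6 ≤ N) (E : List (ℕ × ℕ)) :
    K6C5.IsContained (coreGraph N E) := by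
  have hcore : ∀ a b, K6C5.Adj a b →
      a.val ≠ b.val ∧ ((a.val, b.val) ∈ coreEdges ∨ (b.val, a.val) ∈ coreEdges) := by decide
  refine ⟨⟨⟨Fin.castLE hN, fun {a b} hab => ?_⟩, Fin.castLE_injective hN⟩⟩
  obtain ⟨hne, hmem⟩ := hcore a b hab
  exact ⟨fun h => hne (congrArg Fin.val (Fin.castLE_injective hN h)),
    hmem.imp (List.mem_append_left _) (List.mem_append_left _)⟩

theorem card_neighbors_smallRealizations : ∀ p ∈ smallRealizations,
    6 ≤ p.1 + p.2.1 + p.2.2.1 + p.2.2.2.1 + 1 ∧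
      (univ : Finset (Fin (p.1 + p.2.1 + p.2.2.1 + p.2.2.2.1 + 1))).val.map
        (fun v => #{w | (coreGraph _ p.2.2.2.2).Adj v w}) =
      degreeMultiset p.1 p.2.1 p.2.2.1 p.2.2.2.1 := by
  decide +kernel

theorem realizable_of_mem_smallRealizations {p : ℕ × ℕ × ℕ × ℕ × List (ℕ × ℕ)}
    (hp : p ∈ smallRealizations) :
    RealizableWithCore (degreeMultiset p.1 p.2.1 p.2.2.1 p.2.2.2.1) := by
  obtain ⟨hN, hdeg⟩ := card_neighbors_smallRealizations p hp
  refine ⟨_, inferInstance, coreGraph _ p.2.2.2.2, isContained_coreGraph hN _, ?_⟩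
  rw [← hdeg]
  refine Multiset.map_congr rfl fun v _ => ?_
  rw [Set.ncard_eq_toFinset_card']
  congr 1
  ext w
  simp

/-! ### Reduction to the explicit realizations -/

/-- The multiplicities `(i, j, k, m)` occur in `smallRealizations`, or removing a complete
component or suppressing a vertex of degree two leads to smaller admissible multiplicities. -/
def Reducible (i j k m : ℕ) : Prop :=
  (5 ≤ i ∧ Admissible (i - 5) j k m) ∨ (4 ≤ j ∧ Admissible i (j - 4) k m) ∨
    (3 ≤ k ∧ Admissible i j (k - 3) m) ∨ (2 ≤ m ∧ Admissible i j k (m - 2)) ∨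
    (1 ≤ k ∧ 7 ≤ i + j + k + m ∧ Admissible i j (k - 1) m) ∨
    (i, j, k, m) ∈ smallRealizations.map fun p => (p.1, p.2.1, p.2.2.1, p.2.2.2.1)

instance (i j k m : ℕ) : Decidable (Reducible i j k m) :=
  inferInstanceAs (Decidable (_ ∨ _ ∨ _ ∨ _ ∨ _ ∨ _))

theorem reducible_of_lt : ∀ i < 10, ∀ j < 13, ∀ k < 6, ∀ m < 5,
    Admissible i j k m → Reducible i j k m := by
  decide +kernel

theorem bound_of_mem_exceptions : ∀ p ∈ exceptions,
    p.1 < 5 ∧ p.2.1 < 9 ∧ p.2.2.1 < 3 ∧ p.2.2.2 < 3 := by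
  decide

theorem Admissible.reducible {i j k m : ℕ} (h : Admissible i j k m) :
    Reducible i j k m := by
  obtain ⟨hij, hpar, -⟩ := id h
  by_cases hi : i < 10
  · by_cases hj : j < 13
    · by_cases hk : k < 6
      · by_cases hm : m < 5
        · exact reducible_of_lt i hi j hj k hk m hm h
        · refine .inr (.inr (.inr (.inl ⟨by omega, hij, by omega, fun hex => ?_⟩)))
          have := bound_of_mem_exceptions _ hex
          dsimp only at this
          omega
      · refine .inr (.inr (.inl ⟨by omega, hij, hpar, fun hex => ?_⟩))
        have := bound_of_mem_exceptions _ hex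
        dsimp only at this
        omega
    · refine .inr (.inl ⟨by omega, by omega, by omega, fun hex => ?_⟩)
      have := bound_of_mem_exceptions _ hex
      dsimp only at this
      omega
  · refine .inl ⟨by omega, by omega, hpar, fun hex => ?_⟩
    have := bound_of_mem_exceptions _ hex
    dsimp only at this
    omega

theorem Admissible.realizable {i j k m : ℕ} (h : Admissible i j k m) :
    RealizableWithCore (degreeMultiset i j k m) := by
  induction hN : i + j + k + m using Nat.strong_induction_on generalizing i j k m with
  | _ N ih =>
  rcases h.reducible with
    ⟨hi, h'⟩ | ⟨hj, h'⟩ | ⟨hk, h'⟩ | ⟨hm, h'⟩ | ⟨hk, hlarge, h'⟩ | hmem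
  · obtain ⟨i, rfl⟩ := Nat.exists_eq_add_of_le' hi
    rw [Nat.add_sub_cancel] at h'
    convert (ih _ (by omega) h' rfl).add_complete 5 using 1
    simp only [degreeMultiset, Multiset.replicate_add, Multiset.cons_add]
    abel_nf
  · obtain ⟨j, rfl⟩ := Nat.exists_eq_add_of_le' hj
    rw [Nat.add_sub_cancel] at h'
    convert (ih _ (by omega) h' rfl).add_complete 4 using 1
    simp only [degreeMultiset, Multiset.replicate_add, Multiset.cons_add]
    abel_nf
  · obtain ⟨k, rfl⟩ := Nat.exists_eq_add_of_le' hk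
    rw [Nat.add_sub_cancel] at h'
    convert (ih _ (by omega) h' rfl).add_complete 3 using 1
    simp only [degreeMultiset, Multiset.replicate_add, Multiset.cons_add]
    abel_nf
  · obtain ⟨m, rfl⟩ := Nat.exists_eq_add_of_le' hm
    rw [Nat.add_sub_cancel] at h'
    convert (ih _ (by omega) h' rfl).add_complete 2 using 1
    simp only [degreeMultiset, Multiset.replicate_add, Multiset.cons_add]
    abel_nf
  · obtain ⟨k, rfl⟩ := Nat.exists_eq_add_of_le' hk
    rw [Nat.add_sub_cancel] at h'
    convert (ih _ (by omega) h' rfl).cons_two (by rw [card_degreeMultiset]; omega)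
      (zero_notMem_degreeMultiset _ _ _ _) using 1
    simp only [degreeMultiset, Multiset.replicate_succ, Multiset.cons_add, Multiset.add_cons]
    exact Multiset.cons_swap _ _ _
  · obtain ⟨p, hp, heq⟩ := List.mem_map.1 hmem
    obtain ⟨rfl, rfl, rfl, rfl⟩ := by simpa only [Prod.mk.injEq] using heq
    exact realizable_of_mem_smallRealizations hp

theorem lemma29 (n i j k : ℕ) (hn : 6 ≤ n) (hij : 5 ≤ i + j) (hijk : i + j + k ≤ n - 1)
    (heven : Even ((5 :: (List.replicate i 4 ++ List.replicate j 3 ++ List.replicate k 2 ++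
        List.replicate (n - i - j - k - 1) 1)).sum)) :
    PotentiallyK6C5 (5 :: (List.replicate i 4 ++ List.replicate j 3 ++ List.replicate k 2 ++
        List.replicate (n - i - j - k - 1) 1)) ↔
      (5 :: (List.replicate i 4 ++ List.replicate j 3 ++ List.replicate k 2 ++
        List.replicate (n - i - j - k - 1) 1)) ∉
        ([[5, 3, 3, 3, 3, 3, 2], [5, 3, 3, 3, 3, 3, 2, 2], [5, 3, 3, 3, 3, 3, 3, 3],
          [5, 3, 3, 3, 3, 3, 3, 1], [5, 3, 3, 3, 3, 3, 3, 2, 1], [5, 3, 3, 3, 3, 3, 3, 3, 2],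
          [5, 3, 3, 3, 3, 3, 3, 3, 3, 1], [5, 3, 3, 3, 3, 3, 3, 3, 1, 1],
          [5, 4, 3, 3, 3, 3, 3], [5, 4, 3, 3, 3, 3, 3, 2], [5, 4, 3, 3, 3, 3, 3, 3, 3],
          [5, 4, 3, 3, 3, 3, 3, 3, 1], [5, 4, 4, 3, 3, 3, 3, 3]] : List (List ℕ)) := by
  generalize n - i - j - k - 1 = m at heven ⊢
  constructor
  · intro hpot hmem
    have hviolated : ∀ l ∈ ([[5, 3, 3, 3, 3, 3, 2], [5, 3, 3, 3, 3, 3, 2, 2],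
        [5, 3, 3, 3, 3, 3, 3, 3], [5, 3, 3, 3, 3, 3, 3, 1], [5, 3, 3, 3, 3, 3, 3, 2, 1],
        [5, 3, 3, 3, 3, 3, 3, 3, 2], [5, 3, 3, 3, 3, 3, 3, 3, 3, 1],
        [5, 3, 3, 3, 3, 3, 3, 3, 1, 1], [5, 4, 3, 3, 3, 3, 3], [5, 4, 3, 3, 3, 3, 3, 2],
        [5, 4, 3, 3, 3, 3, 3, 3, 3], [5, 4, 3, 3, 3, 3, 3, 3, 1],
        [5, 4, 4, 3, 3, 3, 3, 3]] : List (List ℕ)),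
        ¬ CountingBound l.get 2 ∨ ¬ CountingBound l.get 3 := by decide +kernel
    rcases hviolated _ hmem with h | h
    · exact h (hpot.countingBound (by norm_num))
    · exact h (hpot.countingBound le_rfl)
  · intro hmem
    have hadm : Admissible i j k m := by
      refine ⟨hij, ?_, fun hex => hmem ?_⟩
      · simp only [List.sum_cons, List.sum_append, List.sum_replicate, smul_eq_mul,
          Nat.even_iff] at heven
        omega
      · simp only [exceptions, List.mem_cons, Prod.mk.injEq, List.not_mem_nil, or_false] at hex
        rcases hex with h | h | h | h | h | h | h | h | h | h | h | h | h <;>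
          obtain ⟨rfl, rfl, rfl, rfl⟩ := h <;> decide
    refine RealizableWithCore.potentiallyK6C5 ?_
    simpa [degreeMultiset, add_assoc, ← Multiset.cons_coe, ← Multiset.coe_add, Multiset.coe_replicate]
      using hadm.realizable
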